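/- For all c ∈ ℝ⟨⟨X⟩⟩ and all x, y ∈ G, the mixed composition product is a right action of the affine feedback group (G, ⋆) on ℝ⟨⟨X⟩⟩: (c ◁ x) ◁ y = c ◁ (x ⋆ y), and c ◁ e = c, where e = (𝟙, 0). -/

import Mathlib

open scoped Classical

/-!  Common setup: noncommutative formal power series ℝ⟨⟨X⟩⟩ over the
alphabet X = {x₀, x₁}.  Words are encoded as lists over `Fin 2`
(the letter `0` is x₀ and `1` is x₁); a series is a function from words
to ℝ, recording its coefficients. -/

/-- Words over the alphabet X = {x₀, x₁}. -/
abbrev Word : Type := List (Fin 2)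

/-- Noncommutative formal power series ℝ⟨⟨X⟩⟩. -/
abbrev Ser : Type := Word → ℝ

/-- The series 𝟙 (the empty word). -/
def one1 : Ser := fun w => if w = [] then 1 else 0

/-- A single word η regarded as a series. -/
def mono (η : Word) : Ser := fun w => if w = η then 1 else 0

/-- Left concatenation of a series by the letter `x_i`. -/
def lc (i : Fin 2) (c : Ser) : Ser := fun w =>
  match w with
  | [] => 0
  | j :: u => if j = i then c u else 0

/-- Auxiliary recursion computing the coefficient of a word `w` in `c ⧢ d`:
`(c ⧢ d)(𝟙) = c(𝟙) d(𝟙)` and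
`(c ⧢ d)(x_i w) = ((x_i⁻¹ c) ⧢ d)(w) + (c ⧢ (x_i⁻¹ d))(w)`,
where `x_i⁻¹` is the left shift.  This dual recursion is exactly the
bilinear extension of the inductive shuffle of words
`(x_i ξ) ⧢ (x_j η) = x_i (ξ ⧢ x_j η) + x_j (x_i ξ ⧢ η)`, `𝟙 ⧢ η = η ⧢ 𝟙 = η`. -/
def shAux : Word → Ser → Ser → ℝ
  | [], c, d => c [] * d []
  | i :: w, c, d => shAux w (fun u => c (i :: u)) d + shAux w c (fun u => d (i :: u))

/-- The shuffle product `⧢` on ℝ⟨⟨X⟩⟩. -/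
def sh (c d : Ser) : Ser := fun w => shAux w c d

/-- Shuffle powers `c^{⧢ k}`. -/
def shPow (c : Ser) : ℕ → Ser
  | 0 => one1
  | k + 1 => sh c (shPow c k)

/-- The shuffle inverse `c^{⧢ -1} = Σ_{k ≥ 0} (𝟙 - c)^{⧢ k}`.
When `c(𝟙) = 1` the sum is locally finite (for each word only finitely many
terms are nonzero) and `∑'` returns it. -/
noncomputable def shInv (c : Ser) : Ser := fun w => ∑' k : ℕ, shPow (one1 - c) k w

/-- Composition product restricted to words: `𝟙 ∘ d = 𝟙`,
`(x₀ η) ∘ d = x₀ (η ∘ d)`, `(x₁ η) ∘ d = x₀ (d ⧢ (η ∘ d))`. -/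
def wordComp : Word → Ser → Ser
  | [], _ => one1
  | i :: η, d => if i = 0 then lc 0 (wordComp η d) else lc 0 (sh d (wordComp η d))

/-- The composition product `c ∘ d = Σ_η c(η) (η ∘ d)`.  For each fixed word
only finitely many terms are nonzero, and `∑'` returns the sum. -/
noncomputable def comp (c d : Ser) : Ser := fun w => ∑' η : Word, c η * wordComp η d w

/-- Membership in the set `G`: pairs `(d₁, d₂)` with `d₁(𝟙) = 1`. -/
def inG (d : Ser × Ser) : Prop := d.1 [] = 1

/-- Mixed composition product restricted to words: `𝟙 ◁ d = 𝟙`,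
`(x₀ η) ◁ d = x₀ (η ◁ d)`,
`(x₁ η) ◁ d = x₁ (d₁ ⧢ (η ◁ d)) + x₀ (d₂ ⧢ (η ◁ d))`. -/
def wordMComp : Word → Ser × Ser → Ser
  | [], _ => one1
  | i :: η, d =>
      if i = 0 then lc 0 (wordMComp η d)
      else lc 1 (sh d.1 (wordMComp η d)) + lc 0 (sh d.2 (wordMComp η d))

/-- The mixed composition product `c ◁ d = Σ_η c(η) (η ◁ d)`. -/
noncomputable def mcomp (c : Ser) (d : Ser × Ser) : Ser :=
  fun w => ∑' η : Word, c η * wordMComp η d w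

/-- Componentwise mixed composition `c ⊲ d = (c₁ ◁ d, c₂ ◁ d)`. -/
noncomputable def tri (c d : Ser × Ser) : Ser × Ser := (mcomp c.1 d, mcomp c.2 d)

/-- Componentwise composition `d ∘̄ c = (d₁ ∘ c, d₂ ∘ c)`. -/
noncomputable def bcomp (d : Ser × Ser) (c : Ser) : Ser × Ser := (comp d.1 c, comp d.2 c)

/-- The group product `⊙` on `G`:
`(c₁, c₂) ⊙ (d₁, d₂) = (c₁ ⧢ d₁, c₂ + d₂ ⧢ c₁)`. -/
def odot (c d : Ser × Ser) : Ser × Ser := (sh c.1 d.1, c.2 + sh d.2 c.1)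

/-- The identity element `e = (𝟙, 0)`. -/
def eG : Ser × Ser := (one1, 0)

/-- The `⊙`-inverse `c^{⊙ -1} = (c₁^{⧢ -1}, -(c₁^{⧢ -1} ⧢ c₂))`. -/
noncomputable def odotInv (c : Ser × Ser) : Ser × Ser :=
  (shInv c.1, -(sh (shInv c.1) c.2))

/-- The affine feedback group product `c ⋆ d = (c ⊲ d) ⊙ d` on `G`. -/
noncomputable def star (c d : Ser × Ser) : Ser × Ser := odot (tri c d) d

/-- The `⋆`-inverse of an element of `G` (defined via choice; for an element
of the group `(G, ⋆)` it is the unique two-sided `⋆`-inverse). -/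
noncomputable def starInv (x : Ser × Ser) : Ser × Ser :=
  if h : ∃ y : Ser × Ser, inG y ∧ star x y = eG ∧ star y x = eG then h.choose else x

/-- The affine feedback product `c @ d = c ◁ ((d^{⊙ -1}) ∘̄ c)^{⋆ -1}`. -/
noncomputable def atp (c : Ser) (d : Ser × Ser) : Ser :=
  mcomp c (starInv (bcomp (odotInv d) c))

/-- Membership in ℝ[[x₀]]: series vanishing on every word containing x₁. -/
def inRx0 (c : Ser) : Prop := ∀ w : Word, (1 : Fin 2) ∈ w → c w = 0

/-- The left shift `x_i⁻¹ c` of a series. -/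
def lshift (i : Fin 2) (c : Ser) : Ser := fun u => c (i :: u)

theorem sh_nil (a b : Ser) : sh a b [] = a [] * b [] := rfl

theorem sh_cons (i : Fin 2) (w : Word) (a b : Ser) :
    sh a b (i :: w) = sh (lshift i a) b w + sh a (lshift i b) w := rfl

theorem lshift_add (i : Fin 2) (a b : Ser) : lshift i (a + b) = lshift i a + lshift i b := rfl

theorem lshift_sh (i : Fin 2) (a b : Ser) :
    lshift i (sh a b) = sh (lshift i a) b + sh a (lshift i b) := rfl

theorem sh_comm (a b : Ser) : sh a b = sh b a := by
  funext w
  induction w generalizing a b with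
  | nil => simp only [sh_nil, mul_comm]
  | cons i w ih => rw [sh_cons, sh_cons, ih, ih a, add_comm]

theorem sh_add (a b c : Ser) : sh a (b + c) = sh a b + sh a c := by
  funext w
  induction w generalizing a b c with
  | nil => simp only [sh_nil, Pi.add_apply, mul_add]
  | cons i w ih =>
    simp only [Pi.add_apply, sh_cons, lshift_add, ih]
    ring

theorem add_sh (a b c : Ser) : sh (a + b) c = sh a c + sh b c := by
  rw [sh_comm, sh_add, sh_comm c, sh_comm c]

theorem sh_smul (r : ℝ) (a b : Ser) : sh a (r • b) = r • sh a b := by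
  funext w
  induction w generalizing a b with
  | nil => simp only [sh_nil, Pi.smul_apply, smul_eq_mul]; ring
  | cons i w ih =>
    have h : lshift i (r • b) = r • lshift i b := rfl
    simp only [sh_cons, Pi.smul_apply, smul_eq_mul, h, ih]
    ring

theorem sh_zero (a : Ser) : sh a 0 = 0 := by
  simpa using sh_smul 0 a 0

theorem zero_sh (a : Ser) : sh 0 a = 0 := by
  rw [sh_comm, sh_zero]

theorem sh_assoc (a b c : Ser) : sh (sh a b) c = sh a (sh b c) := by
  funext w
  induction w generalizing a b c with
  | nil => simp only [sh_nil, mul_assoc]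
  | cons i w ih =>
    simp only [sh_cons, lshift_sh, add_sh, sh_add, Pi.add_apply, ih]
    ring

theorem lshift_one1 (i : Fin 2) : lshift i one1 = 0 := by
  funext w
  simp [lshift, one1]

theorem one1_sh (a : Ser) : sh one1 a = a := by
  funext w
  induction w generalizing a with
  | nil => simp [sh_nil, one1]
  | cons i w ih => simp [sh_cons, lshift_one1, zero_sh, ih, lshift]

/-- The coefficient of `w` in a shuffle product only depends on the coefficients of words that
are no longer than `w`. -/
theorem sh_congr {a a' b b' : Ser} {w : Word} (ha : ∀ u : Word, u.length ≤ w.length → a u = a' u)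
    (hb : ∀ u : Word, u.length ≤ w.length → b u = b' u) : sh a b w = sh a' b' w := by
  induction w generalizing a a' b b' with
  | nil => rw [sh_nil, sh_nil, ha [] le_rfl, hb [] le_rfl]
  | cons i w ih =>
    have hle (u : Word) (h : u.length ≤ w.length) : u.length ≤ (i :: w).length :=
      h.trans (Nat.le_succ _)
    have hcons (u : Word) (h : u.length ≤ w.length) : (i :: u).length ≤ (i :: w).length :=
      Nat.succ_le_succ h
    rw [sh_cons, sh_cons,
      ih (a := lshift i a) (a' := lshift i a') (fun u h => ha (i :: u) (hcons u h)) (fun u h => hb u (hle u h)),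
      ih (b := lshift i b) (b' := lshift i b') (fun u h => ha u (hle u h))
        (fun u h => hb (i :: u) (hcons u h))]

theorem hasSum_sh {ι : Type*} (a : Ser) {g : ι → Ser} {s : Ser}
    (h : ∀ u, HasSum (fun k => g k u) (s u)) (w : Word) :
    HasSum (fun k => sh a (g k) w) (sh a s w) := by
  induction w generalizing a g s with
  | nil => exact (h []).mul_left _
  | cons i w ih => exact (ih _ h).add (ih _ fun u => h (i :: u))

theorem wordMComp_eq_zero {η w : Word} (d : Ser × Ser) (h : w.length < η.length) :
    wordMComp η d w = 0 := by
  induction η generalizing w with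
  | nil => simp at h
  | cons i η ih =>
    cases w with
    | nil => simp only [wordMComp]; split_ifs <;> simp [lc]
    | cons j w =>
      have hw : w.length < η.length := by simpa using h
      have hs (a : Ser) : sh a (wordMComp η d) w = 0 := by
        rw [sh_congr (a' := a) (b' := 0) (fun _ _ => rfl) (fun u hu => ih (hu.trans_lt hw)),
          sh_zero, Pi.zero_apply]
      simp only [wordMComp]
      split_ifs <;> simp [lc, hs, ih hw]

theorem hasSum_mcomp (c : Ser) (d : Ser × Ser) (w : Word) :
    HasSum (fun η => c η * wordMComp η d w) (mcomp c d w) := by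
  refine (summable_of_hasFiniteSupport
    ((List.finite_length_le (Fin 2) w.length).subset fun η hη => ?_)).hasSum
  by_contra hlt
  exact hη (by simp [wordMComp_eq_zero d (not_le.mp hlt)])

theorem hasSum_word {f : Word → ℝ} {s₀ s₁ : ℝ} (h₀ : HasSum (fun η => f (0 :: η)) s₀)
    (h₁ : HasSum (fun η => f (1 :: η)) s₁) : HasSum f (f [] + (s₀ + s₁)) := by
  have key (i : Fin 2) {s : ℝ} (h : HasSum (fun η => f (i :: η)) s) :
      HasSum (fun η : Word => if η.head? = some i then f η else 0) s := by
    refine (Function.Injective.hasSum_iff (g := fun η : Word => i :: η)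
      (fun _ _ h => (List.cons.inj h).2) ?_).mp (by simpa [Function.comp_def] using h)
    rintro (_ | ⟨j, η⟩) hη
    · simp
    · have : j ≠ i := fun hj => hη ⟨η, by rw [hj]⟩
      simp [this]
  convert (hasSum_ite_eq ([] : Word) (f [])).add ((key 0 h₀).add (key 1 h₁)) using 1
  funext η
  rcases η with _ | ⟨j, η⟩
  · simp
  · fin_cases j <;> simp

theorem mcomp_nil (c : Ser) (d : Ser × Ser) : mcomp c d [] = c [] := by
  refine (hasSum_mcomp c d []).unique ?_
  convert hasSum_single (f := fun η => c η * wordMComp η d []) [] ?_ using 1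
  · simp [wordMComp, one1]
  · intro η hη
    simp [wordMComp_eq_zero d (w := []) (List.length_pos_iff.mpr hη)]

theorem hasSum_sh_mcomp (a c : Ser) (d : Ser × Ser) (w : Word) :
    HasSum (fun η => c η * sh a (wordMComp η d) w) (sh a (mcomp c d) w) := by
  simpa only [sh_smul] using! hasSum_sh a (g := fun η => c η • wordMComp η d) (hasSum_mcomp c d) w

theorem lshift_zero_mcomp (c : Ser) (d : Ser × Ser) :
    lshift 0 (mcomp c d) = mcomp (lshift 0 c) d + sh d.2 (mcomp (lshift 1 c) d) := by
  funext w
  refine (hasSum_mcomp c d (0 :: w)).unique ?_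
  convert hasSum_word (f := fun η => c η * wordMComp η d (0 :: w))
    (s₀ := mcomp (lshift 0 c) d w) (s₁ := sh d.2 (mcomp (lshift 1 c) d) w) ?_ ?_ using 1
  · simp [wordMComp, one1]
  · simpa [wordMComp, lc, lshift] using hasSum_mcomp (lshift 0 c) d w
  · simpa [wordMComp, lc, lshift] using hasSum_sh_mcomp d.2 (lshift 1 c) d w

theorem lshift_one_mcomp (c : Ser) (d : Ser × Ser) :
    lshift 1 (mcomp c d) = sh d.1 (mcomp (lshift 1 c) d) := by
  funext w
  refine (hasSum_mcomp c d (1 :: w)).unique ?_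
  convert hasSum_word (f := fun η => c η * wordMComp η d (1 :: w))
    (s₀ := 0) (s₁ := sh d.1 (mcomp (lshift 1 c) d) w) ?_ ?_ using 1
  · simp [wordMComp, one1]
  · simp [wordMComp, lc]
  · simpa [wordMComp, lc, lshift] using hasSum_sh_mcomp d.1 (lshift 1 c) d w

theorem add_mcomp (a b : Ser) (d : Ser × Ser) : mcomp (a + b) d = mcomp a d + mcomp b d := by
  funext w
  refine (hasSum_mcomp (a + b) d w).unique ?_
  simpa only [Pi.add_apply, add_mul] using (hasSum_mcomp a d w).add (hasSum_mcomp b d w)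

theorem mcomp_zero_cons (c : Ser) (d : Ser × Ser) (w : Word) :
    mcomp c d (0 :: w) = mcomp (lshift 0 c) d w + sh d.2 (mcomp (lshift 1 c) d) w :=
  congrFun (lshift_zero_mcomp c d) w

theorem mcomp_one_cons (c : Ser) (d : Ser × Ser) (w : Word) :
    mcomp c d (1 :: w) = sh d.1 (mcomp (lshift 1 c) d) w :=
  congrFun (lshift_one_mcomp c d) w

theorem sh_mcomp (a b : Ser) (d : Ser × Ser) :
    mcomp (sh a b) d = sh (mcomp a d) (mcomp b d) := by
  suffices H : ∀ n : ℕ, ∀ w : Word, w.length ≤ n → ∀ a b : Ser,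
      mcomp (sh a b) d w = sh (mcomp a d) (mcomp b d) w from
    funext fun w => H _ w le_rfl a b
  intro n
  induction n with
  | zero =>
    intro w hw a b
    rw [List.length_eq_zero_iff.mp (Nat.le_zero.mp hw)]
    simp only [mcomp_nil, sh_nil]
  | succ n ih =>
    rintro (_ | ⟨i, w⟩) hw a b
    · simp only [mcomp_nil, sh_nil]
    have hwn : w.length ≤ n := by simpa using hw
    have hs (e a b : Ser) :
        sh e (mcomp (sh a b) d) w = sh e (sh (mcomp a d) (mcomp b d)) w :=
      sh_congr (fun _ _ => rfl) fun u hu => ih u (hu.trans hwn) a b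
    have hswap (e a b : Ser) : sh a (sh e b) = sh e (sh a b) := by
      rw [← sh_assoc, sh_comm a, sh_assoc]
    fin_cases i
    · simp only [Fin.zero_eta, mcomp_zero_cons, sh_cons, lshift_zero_mcomp, lshift_sh, add_mcomp,
        sh_add, add_sh, Pi.add_apply, hs, ih w hwn, sh_assoc, hswap d.2]
      ring
    · simp only [Fin.mk_one, mcomp_one_cons, sh_cons, lshift_one_mcomp, lshift_sh, add_mcomp,
        sh_add, Pi.add_apply, hs, sh_assoc, hswap d.1]

theorem mcomp_mcomp (c : Ser) (x y : Ser × Ser) :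
    mcomp (mcomp c x) y = mcomp c (star x y) := by
  suffices H : ∀ n : ℕ, ∀ w : Word, w.length ≤ n → ∀ c : Ser,
      mcomp (mcomp c x) y w = mcomp c (star x y) w from
    funext fun w => H _ w le_rfl c
  intro n
  induction n with
  | zero =>
    intro w hw c
    rw [List.length_eq_zero_iff.mp (Nat.le_zero.mp hw)]
    simp only [mcomp_nil]
  | succ n ih =>
    rintro (_ | ⟨i, w⟩) hw c
    · simp only [mcomp_nil]
    have hwn : w.length ≤ n := by simpa using hw
    have hs (e c : Ser) : sh e (mcomp (mcomp c x) y) w = sh e (mcomp c (star x y)) w :=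
      sh_congr (fun _ _ => rfl) fun u hu => ih u (hu.trans hwn) c
    fin_cases i
    · have h₂ : (star x y).2 = mcomp x.2 y + sh y.2 (mcomp x.1 y) := rfl
      simp only [Fin.zero_eta, mcomp_zero_cons, lshift_zero_mcomp, lshift_one_mcomp, add_mcomp,
        sh_mcomp, Pi.add_apply, ← sh_assoc, hs, ih w hwn, h₂, add_sh]
      ring
    · have h₁ : (star x y).1 = sh y.1 (mcomp x.1 y) := sh_comm _ _
      simp only [Fin.mk_one, mcomp_one_cons, lshift_one_mcomp, sh_mcomp, ← sh_assoc, hs, h₁]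

theorem mcomp_eG (c : Ser) : mcomp c eG = c := by
  funext w
  induction w generalizing c with
  | nil => exact mcomp_nil c eG
  | cons i w ih =>
    fin_cases i
    · simpa [mcomp_zero_cons, eG, zero_sh, lshift] using ih (lshift 0 c)
    · simpa [mcomp_one_cons, eG, one1_sh, lshift] using ih (lshift 1 c)

/-- the mixed composition product is a right action of the
affine feedback group `(G, ⋆)` on `ℝ⟨⟨X⟩⟩`:
`(c ◁ x) ◁ y = c ◁ (x ⋆ y)` and `c ◁ e = c`. -/
theorem mcomp_right_action (c : Ser) (x y : Ser × Ser)
    (hx : inG x) (hy : inG y) :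
    mcomp (mcomp c x) y = mcomp c (star x y) ∧ mcomp c eG = c :=
  ⟨mcomp_mcomp c x y, mcomp_eG c⟩
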